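/- Let q be a power of 3, let m ≥ 1 and k ≥ 1 be integers, and let r = (r_1,…,r_m) ∈ (𝔽_q)^m be an 𝔽_q-rational point of the affine chart of ℙ^m. Consider triples (A₂, A₄, A₆) of homogeneous polynomials over 𝔽_q in x_0,…,x_m of degrees 2k, 4k, 6k respectively, with dehomogenizations (a₂, a₄, a₆) obtained by setting x_0 = 1. Then the fraction of such triples for which there exist x, y ∈ 𝔽̄_q with y² = x³ + a₂(r)x² + a₄(r)x + a₆(r), 2y = 0, 3x² + 2a₂(r)x + a₄(r) = 0, and (∂a₂/∂u_j)(r)·x² + (∂a₄/∂u_j)(r)·x + (∂a₆/∂u_j)(r) = 0 for all j = 1,…,m, is exactly q^{-(m+1)}. -/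

import Mathlib

open MvPolynomial Filter

noncomputable section

variable (F : Type) [Field F] [Fintype F]

/-- Dehomogenization: substitute `x₀ = 1` and rename `x_{j+1}` to `u_j`. -/
def dehom (m : ℕ) : MvPolynomial (Fin (m + 1)) F →ₐ[F] MvPolynomial (Fin m) F :=
  aeval (Fin.cases 1 X)

/-- The set of triples `(A₂, A₄, A₆)` of homogeneous polynomials of degrees
`2k, 4k, 6k` in `m + 1` variables. -/
def WTriples (m k : ℕ) :
    Set (MvPolynomial (Fin (m + 1)) F × MvPolynomial (Fin (m + 1)) F ×
      MvPolynomial (Fin (m + 1)) F) :=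
  {T | T.1.IsHomogeneous (2 * k) ∧ T.2.1.IsHomogeneous (4 * k) ∧
    T.2.2.IsHomogeneous (6 * k)}

/-- In characteristic 3, the Weierstrass hypersurface
`y² = x³ + a₂x² + a₄x + a₆` (with `aᵢ` the dehomogenization of `Aᵢ`) is singular
at a point lying over the `𝔽_q`-rational affine point `r`. -/
def SingAtAff3 (m : ℕ) (A₂ A₄ A₆ : MvPolynomial (Fin (m + 1)) F)
    (r : Fin m → F) : Prop :=
  ∃ x y : AlgebraicClosure F,
    (letI ρ : Fin m → AlgebraicClosure F := fun j => algebraMap F (AlgebraicClosure F) (r j)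
    y ^ 2 = x ^ 3 + aeval ρ (dehom F m A₂) * x ^ 2 + aeval ρ (dehom F m A₄) * x +
        aeval ρ (dehom F m A₆) ∧
      2 * y = 0 ∧
      3 * x ^ 2 + 2 * aeval ρ (dehom F m A₂) * x + aeval ρ (dehom F m A₄) = 0 ∧
      ∀ j, aeval ρ (pderiv j (dehom F m A₂)) * x ^ 2 + aeval ρ (pderiv j (dehom F m A₄)) * x +
        aeval ρ (pderiv j (dehom F m A₆)) = 0)

/-- The preimage of a set under a surjective additive map is a product with the kernel. -/
theorem card_preimage_of_surjective {V W : Type*} [AddCommGroup V] [AddCommGroup W]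
    (f : V →+ W) (hf : Function.Surjective f) (S : Set W) :
    Nat.card (f ⁻¹' S) = Nat.card f.ker * Nat.card S := by
  obtain ⟨s, hs⟩ := hf.hasRightInverse
  rw [← Nat.card_prod]
  refine Nat.card_congr
    { toFun := fun v => (⟨v.1 - s (f v.1), ?_⟩, ⟨f v.1, v.2⟩)
      invFun := fun p => ⟨p.1.1 + s p.2.1, ?_⟩
      left_inv := ?_
      right_inv := ?_ }
  · simp [AddMonoidHom.mem_ker, hs (f v.1)]
  · have h : f p.1.1 = 0 := p.1.2
    simp [h, hs p.2.1]
  · intro v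
    simp
  · rintro ⟨⟨a, ha⟩, ⟨b, hb⟩⟩
    have h : f a = 0 := ha
    simp [h, hs b]

/-- The value and the gradient at `r` of the dehomogenization of a form of degree `d`. -/
def jet (m d : ℕ) (r : Fin m → F) :
    homogeneousSubmodule (Fin (m + 1)) F d →+ F × (Fin m → F) where
  toFun A := (eval r (dehom F m A), fun j => eval r (pderiv j (dehom F m A)))
  map_zero' := by ext <;> simp
  map_add' A B := by ext <;> simp

theorem jet_surjective (m d : ℕ) (hd : 1 ≤ d) (r : Fin m → F) :
    Function.Surjective (jet F m d r) := by
  rintro ⟨c, g⟩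
  obtain ⟨e, rfl⟩ := Nat.exists_eq_add_of_le' hd
  let A : MvPolynomial (Fin (m + 1)) F :=
    X 0 ^ e * (C c * X 0 + ∑ j : Fin m, C (g j) * (X j.succ - C (r j) * X 0))
  have hA : A.IsHomogeneous (e + 1) := by
    refine (isHomogeneous_X_pow 0 e).mul (((isHomogeneous_X F 0).C_mul c).add ?_)
    exact IsHomogeneous.sum _ _ _ fun j _ =>
      ((isHomogeneous_X F _).sub ((isHomogeneous_X F 0).C_mul _)).C_mul _
  have hdA : dehom F m A = C c + ∑ j : Fin m, C (g j) * (X j - C (r j)) := by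
    simp [A, dehom, ← algebraMap_eq]
  refine ⟨⟨A, hA⟩, ?_⟩
  ext j
  · simp [jet, hdA]
  · simp [jet, hdA, pderiv_X, Pi.single_apply]

/-- The triples of 1-jets at a point of the coefficients of a Weierstrass equation in
characteristic 3 whose hypersurface is singular at a point with `x`-coordinate in `F`. -/
def singJets (m : ℕ) :
    Set ((F × (Fin m → F)) × (F × (Fin m → F)) × (F × (Fin m → F))) :=
  {J | ∃ x : F, x ^ 3 + J.1.1 * x ^ 2 + J.2.1.1 * x + J.2.2.1 = 0 ∧ J.2.1.1 = J.1.1 * x ∧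
    ∀ j, J.1.2 j * x ^ 2 + J.2.1.2 j * x + J.2.2.2 j = 0}

/-- A singular jet is determined by the singular point, the jet of `a₂` and the gradient
of `a₄`. -/
theorem card_singJets [CharP F 3] (m : ℕ) :
    Nat.card (singJets F m) = Fintype.card F ^ (2 * (m + 1)) := by
  let φ : (F × F) × (Fin m → F) × (Fin m → F) → singJets F m := fun p =>
    ⟨((p.1.1, p.2.1), (p.1.1 * p.1.2, p.2.2),
      (-(p.1.2 ^ 3 + p.1.1 * p.1.2 ^ 2 + p.1.1 * p.1.2 * p.1.2),
        fun j => -(p.2.1 j * p.1.2 ^ 2 + p.2.2 j * p.1.2))),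
      p.1.2, by simp, rfl, by simp⟩
  have hφ : Function.Bijective φ := by
    constructor
    · rintro ⟨⟨a, x⟩, g, h⟩ ⟨⟨a', x'⟩, g', h'⟩ H
      replace H := congrArg Subtype.val H
      simp only [φ, Prod.mk.injEq] at H
      obtain ⟨⟨rfl, rfl⟩, ⟨hx, rfl⟩, h6, -⟩ := H
      have hxx : x = x' := by
        by_cases ha : a = 0
        · subst ha
          have : Fact (Nat.Prime 3) := ⟨Nat.prime_three⟩
          apply frobenius_inj F 3
          simpa [frobenius_def] using h6
        · exact mul_left_cancel₀ ha hx
      rw [hxx]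
    · rintro ⟨⟨⟨a, g⟩, ⟨b, h⟩, ⟨c, l⟩⟩, x, h1, h2, h3⟩
      dsimp only at h1 h2 h3
      subst h2
      refine ⟨((a, x), g, h), ?_⟩
      refine Subtype.ext ?_
      simp only [φ, Prod.mk.injEq, true_and]
      exact ⟨by linear_combination -h1, funext fun j => by linear_combination -h3 j⟩
  rw [← Nat.card_eq_of_bijective φ hφ]
  simp only [Nat.card_eq_fintype_card, Fintype.card_prod, Fintype.card_pi, Finset.prod_const,
    Finset.card_univ, Fintype.card_fin]
  ring

/-- The `x`-coordinate of a singular point over a rational point is rational, because it is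
either a ratio of rational elements or the cube root of one. -/
theorem singAtAff3_iff [CharP F 3] (m : ℕ) (A₂ A₄ A₆ : MvPolynomial (Fin (m + 1)) F)
    (r : Fin m → F) :
    SingAtAff3 F m A₂ A₄ A₆ r ↔
      ((eval r (dehom F m A₂), fun j => eval r (pderiv j (dehom F m A₂))),
        (eval r (dehom F m A₄), fun j => eval r (pderiv j (dehom F m A₄))),
        (eval r (dehom F m A₆), fun j => eval r (pderiv j (dehom F m A₆)))) ∈
      singJets F m := by
  let K := AlgebraicClosure F
  have : Fact (Nat.Prime 3) := ⟨Nat.prime_three⟩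
  have : CharP K 3 := charP_of_injective_algebraMap (algebraMap F K).injective 3
  have h3 : (3 : K) = 0 := by exact_mod_cast CharP.cast_eq_zero K 3
  have h2 : (2 : K) ≠ 0 := fun h => one_ne_zero (α := K) (by linear_combination h3 - h)
  have hev (p : MvPolynomial (Fin m) F) :
      aeval (fun j => algebraMap F (AlgebraicClosure F) (r j)) p =
        algebraMap F (AlgebraicClosure F) (eval r p) := by
    rw [← coe_aeval_eq_eval]
    exact aeval_algebraMap_apply K r p
  simp only [SingAtAff3, singJets, Set.mem_ofPred_eq, hev]
  generalize eval r (dehom F m A₂) = a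
  generalize eval r (dehom F m A₄) = b
  generalize eval r (dehom F m A₆) = c
  constructor
  · rintro ⟨x, y, hw, hy, hx, hg⟩
    have hy0 : y = 0 := by simpa [h2] using hy
    have hb : algebraMap F K b = algebraMap F K a * x := by
      linear_combination hx - (x ^ 2 + algebraMap F K a * x) * h3
    obtain ⟨t, rfl⟩ : ∃ t : F, algebraMap F K t = x := by
      by_cases ha : a = 0
      · obtain ⟨t, ht⟩ := surjective_frobenius F 3 (-c)
        refine ⟨t, frobenius_inj K 3 ?_⟩
        rw [frobenius_def] at ht
        simp only [frobenius_def, ← map_pow, ht, map_neg]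
        subst ha hy0
        simp only [map_zero, zero_mul] at hb hw
        rw [hb] at hw
        linear_combination hw
      · refine ⟨b / a, ?_⟩
        rw [map_div₀, hb]
        exact mul_div_cancel_left₀ x (by simpa using ha)
    refine ⟨t, ?_, ?_, fun j => ?_⟩ <;> apply (algebraMap F K).injective
    · simp only [map_add, map_mul, map_pow, map_zero]
      rw [← hw, hy0]; ring
    · simpa using hb
    · simpa using hg j
  · rintro ⟨t, hw, hb, hg⟩
    refine ⟨algebraMap F K t, 0, ?_, by simp, ?_, fun j => ?_⟩
    · rw [← map_pow, ← map_pow, ← map_mul, ← map_mul, ← map_add, ← map_add, ← map_add, hw]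
      simp
    · rw [hb, map_mul]
      linear_combination (algebraMap F K t ^ 2 + algebraMap F K a * algebraMap F K t) * h3
    · simpa using congrArg (algebraMap F K) (hg j)

/-- in characteristic 3, for an `𝔽_q`-rational affine point `r` of
`ℙ^m`, the fraction of triples `(A₂, A₄, A₆)` whose Weierstrass hypersurface is
singular over `r` is exactly `q^{-(m+1)}`. -/
theorem stmt15 [CharP F 3] (m : ℕ) (hm : 1 ≤ m) (k : ℕ) (hk : 1 ≤ k) (r : Fin m → F) :
    Fintype.card F ^ (m + 1) *
        Nat.card {T ∈ WTriples F m k | SingAtAff3 F m T.1 T.2.1 T.2.2 r} =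
      Nat.card (WTriples F m k) := by
  let V (d : ℕ) := homogeneousSubmodule (Fin (m + 1)) F d
  let f : V (2 * k) × V (4 * k) × V (6 * k) →+ _ :=
    (jet F m (2 * k) r).prodMap ((jet F m (4 * k) r).prodMap (jet F m (6 * k) r))
  have hf : Function.Surjective f :=
    (jet_surjective F m _ (by lia) r).prodMap
      ((jet_surjective F m _ (by lia) r).prodMap (jet_surjective F m _ (by lia) r))
  let e : V (2 * k) × V (4 * k) × V (6 * k) ≃ WTriples F m k :=
    { toFun := fun v => ⟨(v.1.1, v.2.1.1, v.2.2.1), v.1.2, v.2.1.2, v.2.2.2⟩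
      invFun := fun T => (⟨T.1.1, T.2.1⟩, ⟨T.1.2.1, T.2.2.1⟩, ⟨T.1.2.2, T.2.2.2⟩)
      left_inv := fun _ => rfl
      right_inv := fun _ => rfl }
  have hsing : Nat.card {T ∈ WTriples F m k | SingAtAff3 F m T.1 T.2.1 T.2.2 r} =
      Nat.card (f ⁻¹' singJets F m) := by
    refine Nat.card_congr ((Equiv.subtypeSubtypeEquivSubtypeInter (· ∈ WTriples F m k)
      (fun T => SingAtAff3 F m T.1 T.2.1 T.2.2 r)).symm.trans
      (e.subtypeEquiv fun v => ?_).symm)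
    exact (singAtAff3_iff F m _ _ _ r).symm
  have hall : Nat.card (WTriples F m k) = Nat.card (f ⁻¹' Set.univ) :=
    Nat.card_congr (e.symm.trans (Equiv.Set.univ _).symm)
  rw [hsing, hall, card_preimage_of_surjective f hf, card_preimage_of_surjective f hf,
    card_singJets, Nat.card_congr (Equiv.Set.univ _)]
  simp only [Nat.card_eq_fintype_card (α := _ × _), Fintype.card_prod, Fintype.card_pi,
    Finset.prod_const, Finset.card_univ, Fintype.card_fin]
  ring
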